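/- arXiv:2203.01410 — 2 statements merged into one kernel-verified Lean document; each statement's English description precedes it below -/
import Mathlib

section
/- Let A be the 6×6 real matrix with rows (0,1,0,0,0,0), (1.000002542612694, 0, 0, 2, 0, 0), (0,0,0,1,0,0), (0, -0.000294117647059, 0, 0, 0, 0), (0,0,0,0,0,1), (0,0,0,0,-0.00000127311747,0), and let B be the 6×2 matrix whose columns are (0,1,0,0,0,0)ᵀ and (0,0,0,0,0,1)ᵀ (thrusters in the r- and z-directions). Then the Kalman controllability matrix Q = [B, AB, A²B, A³B, A⁴B, A⁵B], viewed as a 6×12 real matrix, has rank 5; in particular its rank is strictly less than 6. -/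
/-- Linearized satellite dynamics matrix under the `J₂` zonal harmonic. -/
def A : Matrix (Fin 6) (Fin 6) ℝ :=
  !![0, 1, 0, 0, 0, 0;
     1.000002542612694, 0, 0, 2, 0, 0;
     0, 0, 0, 1, 0, 0;
     0, -0.000294117647059, 0, 0, 0, 0;
     0, 0, 0, 0, 0, 1;
     0, 0, 0, 0, -0.00000127311747, 0]

/-- Input matrix: thruster columns. -/
def B : Matrix (Fin 6) (Fin 2) ℝ :=
  !![0, 0;
     1, 0;
     0, 0;
     0, 0;
     0, 0;
     0, 1]

/-- Kalman controllability matrix `Q = [B, AB, A²B, A³B, A⁴B, A⁵B]`,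
viewed as a `6 × 12` real matrix with columns indexed by `Fin 6 × Fin 2`. -/
def Q : Matrix (Fin 6) (Fin 6 × Fin 2) ℝ :=
  Matrix.of fun i p => (A ^ (p.1 : ℕ) * B) i p.2

/-- A basis of the reachable subspace, as columns. -/
def reachableBasis : Matrix (Fin 6) (Fin 5) ℝ :=
  !![0, 1, 0, 0, 0;
     1, 0, 0, 0, 0;
     0, 0, 1, 0, 0;
     0, -0.000294117647059, 0, 0, 0;
     0, 0, 0, 1, 0;
     0, 0, 0, 0, 1]

/-- The restriction of `A` to the reachable subspace, in the basis `reachableBasis`. -/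
def reachableDynamics : Matrix (Fin 5) (Fin 5) ℝ :=
  !![0, 1.000002542612694 - 2 * 0.000294117647059, 0, 0, 0;
     1, 0, 0, 0, 0;
     0, -0.000294117647059, 0, 0, 0;
     0, 0, 0, 0, 1;
     0, 0, 0, -0.00000127311747, 0]

/-- The coordinates of the columns of `B` in the basis `reachableBasis`. -/
def reachableInput : Matrix (Fin 5) (Fin 2) ℝ :=
  !![1, 0;
     0, 0;
     0, 0;
     0, 0;
     0, 1]

lemma A_mul_reachableBasis : A * reachableBasis = reachableBasis * reachableDynamics := by
  ext i j
  fin_cases i <;> fin_cases j <;>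
    norm_num [A, reachableBasis, reachableDynamics, Matrix.mul_apply, Fin.sum_univ_succ]

lemma B_eq_reachableBasis_mul : B = reachableBasis * reachableInput := by
  ext i j
  fin_cases i <;> fin_cases j <;>
    norm_num [B, reachableBasis, reachableInput, Matrix.mul_apply, Fin.sum_univ_succ]

lemma A_pow_mul_B (k : ℕ) :
    A ^ k * B = reachableBasis * (reachableDynamics ^ k * reachableInput) := by
  have h : A ^ k * reachableBasis = reachableBasis * reachableDynamics ^ k := by
    induction k with
    | zero => simp
    | succ k ih =>
      rw [pow_succ, pow_succ, Matrix.mul_assoc, A_mul_reachableBasis, ← Matrix.mul_assoc, ih,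
        Matrix.mul_assoc]
  rw [B_eq_reachableBasis_mul, ← Matrix.mul_assoc, h, Matrix.mul_assoc]

lemma Q_eq_reachableBasis_mul :
    Q = reachableBasis * Matrix.of fun i (p : Fin 6 × Fin 2) =>
      (reachableDynamics ^ (p.1 : ℕ) * reachableInput) i p.2 := by
  ext i p
  rw [Q, Matrix.of_apply, A_pow_mul_B]
  rfl

lemma rank_Q_le : Q.rank ≤ 5 := by
  rw [Q_eq_reachableBasis_mul]
  exact (Matrix.rank_mul_le_left _ _).trans (Matrix.rank_le_width _)

lemma A_mul_B :
    A * B =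
      !![1, 0;
         0, 0;
         0, 0;
         -0.000294117647059, 0;
         0, 1;
         0, 0] := by
  ext i j
  fin_cases i <;> fin_cases j <;> norm_num [A, B, Matrix.mul_apply, Fin.sum_univ_succ]

lemma A_sq_mul_B :
    A ^ 2 * B =
      !![0, 0;
         1.000002542612694 - 2 * 0.000294117647059, 0;
         -0.000294117647059, 0;
         0, 0;
         0, 0;
         0, -0.00000127311747] := by
  rw [pow_two, Matrix.mul_assoc, A_mul_B]
  ext i j
  fin_cases i <;> fin_cases j <;> norm_num [A, Matrix.mul_apply, Fin.sum_univ_succ]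

/-- A nonsingular `5 × 5` minor of `Q`. -/
lemma Q_submatrix :
    Q.submatrix ![1, 0, 2, 4, 5] ![(0, 0), (1, 0), (2, 0), (1, 1), (0, 1)] =
      !![1, 0, 1.000002542612694 - 2 * 0.000294117647059, 0, 0;
         0, 1, 0, 0, 0;
         0, 0, -0.000294117647059, 0, 0;
         0, 0, 0, 1, 0;
         0, 0, 0, 0, 1] := by
  ext i j
  fin_cases i <;> fin_cases j <;>
    simp [Q, A_mul_B, A_sq_mul_B] <;> simp [B]

lemma five_le_rank_Q : 5 ≤ Q.rank := by
  have hdet : (Q.submatrix ![1, 0, 2, 4, 5]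
      ![(0, 0), (1, 0), (2, 0), (1, 1), (0, 1)]).det ≠ 0 := by
    rw [Q_submatrix, Matrix.det_of_isUpperTriangular]
    · norm_num [Fin.prod_univ_succ]
    · intro i j hij
      fin_cases i <;> fin_cases j <;> simp_all
  have hrank := Matrix.rank_of_isUnit _ ((Matrix.isUnit_iff_isUnit_det _).2 hdet.isUnit)
  rw [Fintype.card_fin] at hrank
  exact hrank.symm.le.trans <| Matrix.rank_submatrix_le _ _ _

theorem kalman_rank_rz : Q.rank = 5 ∧ Q.rank < 6 := by
  have h : Q.rank = 5 := le_antisymm rank_Q_le five_le_rank_Q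
  exact ⟨h, by omega⟩
end

section
/- Let A be the 6×6 real matrix with rows (0,1,0,0,0,0), (1.000002542612694, 0, 0, 2, 0, 0), (0,0,0,1,0,0), (0, -0.000294117647059, 0, 0, 0, 0), (0,0,0,0,0,1), (0,0,0,0,-0.00000127311747,0), and let B be the 6×2 matrix whose columns are (0,1,0,0,0,0)ᵀ and (0,0,0,0,0,1)ᵀ (thrusters in the r- and z-directions). Then the linear control system ẋ(t) = A x(t) + B u(t) is not controllable: for every t₀ < t₁ in ℝ there exists a target state x₁ ∈ ℝ⁶ such that for every continuous control u : ℝ → ℝ² and every differentiable trajectory x : ℝ → ℝ⁶ satisfying x′(t) = A x(t) + B u(t) for all t and x(t₀) = 0, one has x(t₁) ≠ x₁. -/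
/-- The quantity `x 3 + c * x 0` is conserved along every trajectory, whatever the control. -/
lemma first_integral_const {u : ℝ → Fin 2 → ℝ} {x : ℝ → Fin 6 → ℝ}
    (hx : ∀ t : ℝ, HasDerivAt x (A.mulVec (x t) + B.mulVec (u t)) t) (s t : ℝ) :
    x s 3 + 0.000294117647059 * x s 0 = x t 3 + 0.000294117647059 * x t 0 := by
  have hderiv : ∀ t, HasDerivAt (fun t => x t 3 + 0.000294117647059 * x t 0) 0 t := by
    intro t
    have h := hasDerivAt_pi.1 (hx t)
    refine ((h 3).add ((h 0).const_mul (0.000294117647059 : ℝ))).congr_deriv ?_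
    simp [A, B, dotProduct, Fin.sum_univ_succ]
  exact is_const_of_deriv_eq_zero (fun t => (hderiv t).differentiableAt)
    (fun t => (hderiv t).deriv) s t

theorem not_controllable_rz :
    ∀ t₀ t₁ : ℝ, t₀ < t₁ →
      ∃ x₁ : Fin 6 → ℝ, ∀ u : ℝ → Fin 2 → ℝ, Continuous u →
        ∀ x : ℝ → Fin 6 → ℝ,
          (∀ t : ℝ, HasDerivAt x (A.mulVec (x t) + B.mulVec (u t)) t) →
          x t₀ = 0 → x t₁ ≠ x₁ := by
  intro t₀ t₁ _
  refine ⟨Pi.single 3 1, fun u _ x hx h₀ h₁ => ?_⟩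
  have h := first_integral_const hx t₁ t₀
  rw [h₀, h₁] at h
  simp at h
end
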